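/- arXiv:math/0206270 — 4 statements merged into one kernel-verified Lean document; each statement's English description precedes it below -/
import Mathlib

section
/- Let α > 0, ω ∈ (1/2, 1), β > αω, κ = √(β² − α²ω²)/(2ω) and I_ε = ω² − εκ. Then there exists ε₀ > 0 such that for all ε ∈ (0, ε₀): ω²/3 < I_ε < ω², the radicand R₀ = (ω² − I_ε)(3I_ε − ω²) is strictly positive, and λ₀⁺ = −εα + 2√R₀ > 0. -/
/-- The radicand `R_n = (n²/2 + ω² − I)(3I − ω² − n²/2)`. -/
noncomputable def radicand (ω I : ℝ) (n : ℕ) : ℝ :=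
  ((n : ℝ) ^ 2 / 2 + ω ^ 2 - I) * (3 * I - ω ^ 2 - (n : ℝ) ^ 2 / 2)

/-- The eigenvalue `λ_n⁺ = −ε(α + n²) + 2√R_n`, interpreted as
`−ε(α + n²) + 2i√(−R_n)` when the radicand `R_n` is negative. -/
noncomputable def lamP (ε α ω I : ℝ) (n : ℕ) : ℂ :=
  if 0 ≤ radicand ω I n then
    ((-ε * (α + (n : ℝ) ^ 2) + 2 * Real.sqrt (radicand ω I n) : ℝ) : ℂ)
  else ((-ε * (α + (n : ℝ) ^ 2) : ℝ) : ℂ)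
    + 2 * (Real.sqrt (-radicand ω I n) : ℝ) * Complex.I

/-- The eigenvalue `λ_n⁻ = −ε(α + n²) − 2√R_n`, interpreted as
`−ε(α + n²) − 2i√(−R_n)` when the radicand `R_n` is negative. -/
noncomputable def lamM (ε α ω I : ℝ) (n : ℕ) : ℂ :=
  if 0 ≤ radicand ω I n then
    ((-ε * (α + (n : ℝ) ^ 2) - 2 * Real.sqrt (radicand ω I n) : ℝ) : ℂ)
  else ((-ε * (α + (n : ℝ) ^ 2) : ℝ) : ℂ)
    - 2 * (Real.sqrt (-radicand ω I n) : ℝ) * Complex.I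

/-- `κ = √(β² − α²ω²)/(2ω)`. -/
noncomputable def kappa (α β ω : ℝ) : ℝ := Real.sqrt (β ^ 2 - α ^ 2 * ω ^ 2) / (2 * ω)

/-- `I_ε = ω² − εκ`, the leading-order squared amplitude of the saddle `Q_ε`. -/
noncomputable def Ieps (α β ω ε : ℝ) : ℝ := ω ^ 2 - ε * kappa α β ω

/-- For `α > 0`, `ω ∈ (1/2, 1)`, `β > αω`, there is `ε₀ > 0` such that for all
`ε ∈ (0, ε₀)`: `ω²/3 < I_ε < ω²`, the radicand `R₀ = (ω² − I_ε)(3I_ε − ω²)` is strictly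
positive, and `λ₀⁺ = −εα + 2√R₀ > 0`. -/
theorem lam0P_pos (α β ω : ℝ) (hα : 0 < α) (hω : ω ∈ Set.Ioo (1 / 2 : ℝ) 1)
    (hβ : α * ω < β) :
    ∃ ε₀ > (0 : ℝ), ∀ ε ∈ Set.Ioo (0 : ℝ) ε₀,
      ω ^ 2 / 3 < Ieps α β ω ε ∧ Ieps α β ω ε < ω ^ 2 ∧
      0 < (ω ^ 2 - Ieps α β ω ε) * (3 * Ieps α β ω ε - ω ^ 2) ∧
      lamP ε α ω (Ieps α β ω ε) 0 =
        ((-ε * α + 2 * Real.sqrt ((ω ^ 2 - Ieps α β ω ε) * (3 * Ieps α β ω ε - ω ^ 2)) : ℝ) : ℂ) ∧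
      0 < -ε * α + 2 * Real.sqrt ((ω ^ 2 - Ieps α β ω ε) * (3 * Ieps α β ω ε - ω ^ 2)) := by
  obtain ⟨hω1, -⟩ := hω
  have hω0 : 0 < ω := by linarith
  have hαω : 0 < α * ω := mul_pos hα hω0
  have hκ : 0 < kappa α β ω := by
    unfold kappa
    have : 0 < β ^ 2 - α ^ 2 * ω ^ 2 := by nlinarith
    positivity
  unfold Ieps
  generalize kappa α β ω = κ at hκ ⊢
  refine ⟨2 * κ * ω ^ 2 / (α ^ 2 + 3 * κ ^ 2), by positivity, ?_⟩
  rintro ε ⟨hε, hε'⟩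
  rw [lt_div_iff₀ (by positivity)] at hε'
  have hεκ : 0 < ε * κ := mul_pos hε hκ
  have hεα : 0 < ε * α ^ 2 := by positivity
  have hlt : 3 * (ε * κ) < 2 * ω ^ 2 := by
    refine lt_of_mul_lt_mul_left ?_ hκ.le
    linarith
  have hR : 0 < (ω ^ 2 - (ω ^ 2 - ε * κ)) * (3 * (ω ^ 2 - ε * κ) - ω ^ 2) :=
    mul_pos (by linarith) (by linarith)
  refine ⟨by linarith, by linarith, hR, ?_, ?_⟩
  · have hrad : radicand ω (ω ^ 2 - ε * κ) 0 =
        (ω ^ 2 - (ω ^ 2 - ε * κ)) * (3 * (ω ^ 2 - ε * κ) - ω ^ 2) := by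
      simp [radicand]
    rw [lamP, hrad, if_pos hR.le]
    simp
  · have hsqrt : ε * α / 2 <
        Real.sqrt ((ω ^ 2 - (ω ^ 2 - ε * κ)) * (3 * (ω ^ 2 - ε * κ) - ω ^ 2)) := by
      apply Real.lt_sqrt_of_sq_lt
      have h : ε * (ε * (α ^ 2 / 4 + 3 * κ ^ 2)) < ε * (2 * κ * ω ^ 2) :=
        mul_lt_mul_of_pos_left (by linarith) hε
      linarith
    linarith
end

section
/- Let α > 0, ω ∈ (1/2, 1), β > αω, κ = √(β² − α²ω²)/(2ω) and I_ε = ω² − εκ. Then there exists ε₀ > 0 such that for all ε ∈ (0, ε₀), among all the eigenvalues λ_n^± (n ≥ 0, computed with I = I_ε) exactly two have positive real part, namely λ₀⁺ and λ₁⁺, and all the remaining eigenvalues λ₀⁻, λ₁⁻ and λ_n^± (n ≥ 2) have strictly negative real part. -/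
/-- The real part of `λ_n⁻` is negative as soon as the damping `ε(α + n²)` is positive. -/
theorem lamM_re_neg {ε α : ℝ} (ω I : ℝ) {n : ℕ} (h : 0 < ε * (α + (n : ℝ) ^ 2)) :
    (lamM ε α ω I n).re < 0 := by
  unfold lamM
  split_ifs
  · rw [Complex.ofReal_re]
    linarith [Real.sqrt_nonneg (radicand ω I n)]
  · simp only [Complex.sub_re, Complex.ofReal_re, Complex.mul_re,
      Complex.mul_im, Complex.re_ofNat, Complex.im_ofNat, Complex.ofReal_im, Complex.I_re,
      Complex.I_im]
    linarith

/-- If the radicand is negative and the damping is positive, then `λ_n⁺` is stable. -/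
theorem lamP_re_neg {ε α ω I : ℝ} {n : ℕ} (h : 0 < ε * (α + (n : ℝ) ^ 2))
    (hR : radicand ω I n < 0) : (lamP ε α ω I n).re < 0 := by
  rw [lamP, if_neg hR.not_ge]
  simp only [Complex.add_re, Complex.ofReal_re, Complex.mul_re,
    Complex.mul_im, Complex.re_ofNat, Complex.im_ofNat, Complex.ofReal_im, Complex.I_re,
    Complex.I_im]
  linarith

/-- `λ_n⁺` is unstable when `4 R_n` exceeds the square of the damping. -/
theorem lamP_re_pos {ε α ω I : ℝ} {n : ℕ}
    (hR : (ε * (α + (n : ℝ) ^ 2)) ^ 2 < 4 * radicand ω I n) : 0 < (lamP ε α ω I n).re := by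
  have h0 : 0 ≤ radicand ω I n := by nlinarith [sq_nonneg (ε * (α + (n : ℝ) ^ 2))]
  rw [lamP, if_pos h0, Complex.ofReal_re]
  have : ε * (α + (n : ℝ) ^ 2) / 2 < Real.sqrt (radicand ω I n) :=
    Real.lt_sqrt_of_sq_lt (by linarith [div_pow (ε * (α + (n : ℝ) ^ 2)) 2 2])
  linarith

theorem kappa_pos {α β ω : ℝ} (hα : 0 < α) (hω : 0 < ω) (hβ : α * ω < β) :
    0 < kappa α β ω := by
  have h : 0 < β ^ 2 - α ^ 2 * ω ^ 2 := by nlinarith [mul_pos hα hω]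
  exact div_pos (Real.sqrt_pos.2 h) (by linarith)

/-- For `α > 0`, `ω ∈ (1/2, 1)`, `β > αω`, there is `ε₀ > 0` such that for all
`ε ∈ (0, ε₀)`, among all the eigenvalues `λ_n^±` (computed with `I = I_ε`) exactly two
have positive real part, namely `λ₀⁺` and `λ₁⁺`; all the remaining eigenvalues
`λ₀⁻`, `λ₁⁻` and `λ_n^±` (`n ≥ 2`) have strictly negative real part. -/
theorem exactly_two_unstable_eigenvalues (α β ω : ℝ) (hα : 0 < α)
    (hω : ω ∈ Set.Ioo (1 / 2 : ℝ) 1) (hβ : α * ω < β) :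
    ∃ ε₀ > (0 : ℝ), ∀ ε ∈ Set.Ioo (0 : ℝ) ε₀,
      0 < (lamP ε α ω (Ieps α β ω ε) 0).re ∧
      0 < (lamP ε α ω (Ieps α β ω ε) 1).re ∧
      (lamM ε α ω (Ieps α β ω ε) 0).re < 0 ∧
      (lamM ε α ω (Ieps α β ω ε) 1).re < 0 ∧
      ∀ n : ℕ, 2 ≤ n →
        (lamP ε α ω (Ieps α β ω ε) n).re < 0 ∧
        (lamM ε α ω (Ieps α β ω ε) n).re < 0 := by
  obtain ⟨hω1, hω2⟩ := hω
  have hk : 0 < kappa α β ω := kappa_pos hα (by linarith) hβ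
  have hωsq : 1 / 4 < ω ^ 2 := by nlinarith
  have hωsq' : ω ^ 2 < 1 := by nlinarith
  simp only [Ieps]
  set k := kappa α β ω
  have hd : 0 < 2 * ω ^ 2 - 1 / 2 := by linarith
  refine ⟨min (min 1 (2 * k / (α ^ 2 + 12 * k ^ 2)))
    (min ((2 * ω ^ 2 - 1 / 2) / (6 * k)) ((2 * ω ^ 2 - 1 / 2) / (α + 1) ^ 2)),
    by positivity, ?_⟩
  rintro ε ⟨hε, hε'⟩
  simp only [lt_min_iff] at hε'
  obtain ⟨⟨h1, h2⟩, h3, h4⟩ := hε'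
  rw [lt_div_iff₀ (by positivity)] at h2 h3 h4
  have hεk : 0 < ε * k := mul_pos hε hk
  have hdamp (n : ℕ) : 0 < ε * (α + (n : ℝ) ^ 2) := by positivity
  refine ⟨lamP_re_pos ?_, lamP_re_pos ?_, lamM_re_neg _ _ (hdamp 0), lamM_re_neg _ _ (hdamp 1),
    fun n hn => ⟨lamP_re_neg (hdamp n) ?_, lamM_re_neg _ _ (hdamp n)⟩⟩
  · simp only [radicand, Nat.cast_zero]
    have h5 : ε * (α ^ 2 + 12 * k ^ 2) < 8 * k * ω ^ 2 := by nlinarith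
    linarith [mul_lt_mul_of_pos_left h5 hε]
  · simp only [radicand, Nat.cast_one]
    have h5 : (ε * (α + 1 ^ 2)) ^ 2 < 2 * ω ^ 2 - 1 / 2 := by
      have : ε * (ε * (α + 1) ^ 2) ≤ 1 * (ε * (α + 1) ^ 2) :=
        mul_le_mul_of_nonneg_right h1.le (by positivity)
      linarith
    nlinarith [mul_pos hεk (show 0 < 2 * ω ^ 2 - 1 / 2 - 3 * (ε * k) by linarith)]
  · have hn' : (2 : ℝ) ≤ n := by exact_mod_cast hn
    have hn2 : (4 : ℝ) ≤ (n : ℝ) ^ 2 := by nlinarith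
    exact mul_neg_of_pos_of_neg (by linarith) (by linarith)
end

section
/- Let α > 0, ω ∈ (1/2, 1), β > αω, κ = √(β² − α²ω²)/(2ω) and I_ε = ω² − εκ. Then there exists ε₀ > 0 such that for all ε ∈ (0, ε₀): Re λ₀⁺ < Re λ₁⁺, i.e. −εα + 2√((ω² − I_ε)(3I_ε − ω²)) < −ε(α + 1) + 2√((1/2 + ω² − I_ε)(3I_ε − ω² − 1/2)). -/
/-- The real part of `lamP` is given by one formula for both signs of the radicand, because
`Real.sqrt` vanishes on negative reals. -/
theorem re_lamP (ε α ω I : ℝ) (n : ℕ) :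
    (lamP ε α ω I n).re = -ε * (α + (n : ℝ) ^ 2) + 2 * Real.sqrt (radicand ω I n) := by
  unfold lamP
  split_ifs with h
  · exact Complex.ofReal_re _
  · rw [Real.sqrt_eq_zero_of_nonpos (not_le.mp h).le]
    rw [Complex.add_re, Complex.ofReal_re]
    simp

/-- For `α > 0`, `ω ∈ (1/2, 1)`, `β > αω`, there is `ε₀ > 0` such that for all
`ε ∈ (0, ε₀)`: `Re λ₀⁺ < Re λ₁⁺`, i.e.
`−εα + 2√((ω² − I_ε)(3I_ε − ω²)) < −ε(α + 1) + 2√((1/2 + ω² − I_ε)(3I_ε − ω² − 1/2))`. -/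
theorem re_lam0P_lt_re_lam1P (α β ω : ℝ) (hα : 0 < α)
    (hω : ω ∈ Set.Ioo (1 / 2 : ℝ) 1) (hβ : α * ω < β) :
    ∃ ε₀ > (0 : ℝ), ∀ ε ∈ Set.Ioo (0 : ℝ) ε₀,
      (lamP ε α ω (Ieps α β ω ε) 0).re < (lamP ε α ω (Ieps α β ω ε) 1).re ∧
      -ε * α + 2 * Real.sqrt ((ω ^ 2 - Ieps α β ω ε) * (3 * Ieps α β ω ε - ω ^ 2)) <
        -ε * (α + 1) + 2 * Real.sqrt
          ((1 / 2 + ω ^ 2 - Ieps α β ω ε) * (3 * Ieps α β ω ε - ω ^ 2 - 1 / 2)) := by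
  have hcont : Continuous fun ε : ℝ => -ε * (α + 1) + 2 * Real.sqrt
      ((1 / 2 + ω ^ 2 - Ieps α β ω ε) * (3 * Ieps α β ω ε - ω ^ 2 - 1 / 2)) -
      (-ε * α + 2 * Real.sqrt ((ω ^ 2 - Ieps α β ω ε) * (3 * Ieps α β ω ε - ω ^ 2))) := by
    unfold Ieps
    fun_prop
  have hpos : 0 < Real.sqrt ((1 / 2 + ω ^ 2 - ω ^ 2) * (3 * ω ^ 2 - ω ^ 2 - 1 / 2)) := by
    apply Real.sqrt_pos.mpr
    nlinarith [hω.1]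
  have hev := (hcont.tendsto 0).eventually_const_lt (u := (0 : ℝ))
    (by simpa [Ieps] using hpos)
  obtain ⟨ε₀, hε₀, hball⟩ := Metric.eventually_nhds_iff.mp hev
  refine ⟨ε₀, hε₀, fun ε hε => ?_⟩
  have key := sub_pos.mp (hball (y := ε) (by
    rw [Real.dist_eq, sub_zero, abs_of_pos hε.1]
    exact hε.2))
  refine ⟨?_, key⟩
  simpa [re_lamP, radicand] using key
end

section
/- Let α > 0, ω ∈ (1/2, 1), β > αω, κ = √(β² − α²ω²)/(2ω) and I_ε = ω² − εκ. Then there exists ε₀ > 0 such that for all ε ∈ (0, ε₀): |Re λ₂^±| < Re λ₀⁺, i.e. ε(α + 4) < −εα + 2√((ω² − I_ε)(3I_ε − ω²)). (This is the Silnikov condition that the smallest attracting rate is strictly smaller than the smallest repelling rate.) -/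
theorem lamP_re_of_radicand_neg (ε α : ℝ) {ω I : ℝ} {n : ℕ} (h : radicand ω I n < 0) :
    (lamP ε α ω I n).re = -ε * (α + (n : ℝ) ^ 2) := by
  rw [lamP, if_neg h.not_ge, Complex.add_re, Complex.ofReal_re]
  simp

theorem lamM_re_of_radicand_neg (ε α : ℝ) {ω I : ℝ} {n : ℕ} (h : radicand ω I n < 0) :
    (lamM ε α ω I n).re = -ε * (α + (n : ℝ) ^ 2) := by
  rw [lamM, if_neg h.not_ge, Complex.sub_re, Complex.ofReal_re]
  simp

theorem lamP_re_of_radicand_nonneg (ε α : ℝ) {ω I : ℝ} {n : ℕ} (h : 0 ≤ radicand ω I n) :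
    (lamP ε α ω I n).re = -ε * (α + (n : ℝ) ^ 2) + 2 * Real.sqrt (radicand ω I n) := by
  rw [lamP, if_pos h, Complex.ofReal_re]

/-- For `α > 0`, `ω ∈ (1/2, 1)`, `β > αω`, there is `ε₀ > 0` such that for all
`ε ∈ (0, ε₀)`: `|Re λ₂^±| < Re λ₀⁺`, i.e.
`ε(α + 4) < −εα + 2√((ω² − I_ε)(3I_ε − ω²))`.
(The Silnikov condition: the smallest attracting rate is strictly smaller than the
smallest repelling rate.) -/
theorem silnikov_condition (α β ω : ℝ) (hα : 0 < α)
    (hω : ω ∈ Set.Ioo (1 / 2 : ℝ) 1) (hβ : α * ω < β) :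
    ∃ ε₀ > (0 : ℝ), ∀ ε ∈ Set.Ioo (0 : ℝ) ε₀,
      |(lamP ε α ω (Ieps α β ω ε) 2).re| < (lamP ε α ω (Ieps α β ω ε) 0).re ∧
      |(lamM ε α ω (Ieps α β ω ε) 2).re| < (lamP ε α ω (Ieps α β ω ε) 0).re ∧
      ε * (α + 4) <
        -ε * α + 2 * Real.sqrt ((ω ^ 2 - Ieps α β ω ε) * (3 * Ieps α β ω ε - ω ^ 2)) := by
  have hω0 : 0 < ω := by linarith [hω.1]
  have hk := kappa_pos hα hω0 hβ
  have hD : 0 < (α + 2) ^ 2 + 3 * kappa α β ω ^ 2 := by positivity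
  refine ⟨2 * ω ^ 2 * kappa α β ω / ((α + 2) ^ 2 + 3 * kappa α β ω ^ 2), by positivity, ?_⟩
  rintro ε ⟨hε, hε'⟩
  rw [lt_div_iff₀ hD] at hε'
  have hεk : 0 < ε * kappa α β ω := mul_pos hε hk
  have hR₀ : radicand ω (Ieps α β ω ε) 0 =
      (ω ^ 2 - Ieps α β ω ε) * (3 * Ieps α β ω ε - ω ^ 2) := by
    simp [radicand]
  have hR₂ : radicand ω (Ieps α β ω ε) 2 < 0 := by
    unfold radicand Ieps
    push_cast
    exact mul_neg_of_pos_of_neg (by linarith) (by nlinarith [hω.2])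
  have hlt : (ε * (α + 2)) ^ 2 < radicand ω (Ieps α β ω ε) 0 := by
    rw [hR₀, Ieps]
    linear_combination ε * hε'
  have hsqrt : ε * (α + 2) < Real.sqrt (radicand ω (Ieps α β ω ε) 0) :=
    Real.lt_sqrt_of_sq_lt hlt
  have habs : |-ε * (α + ((2 : ℕ) : ℝ) ^ 2)| = ε * (α + 4) := by
    rw [neg_mul, abs_neg, abs_of_pos (by positivity)]
    norm_num
  have hre := lamP_re_of_radicand_nonneg ε α ((sq_nonneg _).trans hlt.le)
  rw [lamP_re_of_radicand_neg ε α hR₂, lamM_re_of_radicand_neg ε α hR₂, habs, hre, ← hR₀]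
  push_cast
  refine ⟨?_, ?_, ?_⟩ <;> linarith
end
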